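/- Let p, q ≥ 1 be integers and σ1, σ2 ∈ {1,−1} with (p,σ1) ≠ (1,1). If (−1)^{p+q} = −σ1σ2 (equivalently, the weight p+q and the quantity (1+σ1σ2)/2 have the same parity), then the double t̃-value t̃(p,q;σ1,σ2) lies in the subalgebra of ℝ generated over ℚ by the set {π, ln 2, G} ∪ {ζ(2k+1) : k ≥ 1} ∪ {β(2k) : k ≥ 2}. -/

import Mathlib

open scoped BigOperators

/-- Double t̃-value `t̃(s1,s2;σ1,σ2) = ∑_{n>k≥1} σ1^n σ2^k /((n-1/2)^{s1} (k-1/2)^{s2})`. -/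
noncomputable def dtt (s1 s2 : ℕ) (σ1 σ2 : ℝ) : ℝ :=
  ∑' x : {p : ℕ × ℕ // 0 < p.2 ∧ p.2 < p.1},
    σ1 ^ x.1.1 * σ2 ^ x.1.2 /
      (((x.1.1 : ℝ) - 1 / 2) ^ s1 * ((x.1.2 : ℝ) - 1 / 2) ^ s2)

/-- The Riemann zeta value `ζ(s) = ∑_{n≥1} 1/n^s`. -/
noncomputable def zetaVal (s : ℕ) : ℝ := ∑' n : ℕ, 1 / ((n : ℝ) + 1) ^ s

/-- The Dirichlet beta value `β(s) = ∑_{n≥1} (-1)^{n-1}/(2n-1)^s`. -/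
noncomputable def betaVal (s : ℕ) : ℝ := ∑' n : ℕ, (-1 : ℝ) ^ n / (2 * (n : ℝ) + 1) ^ s

open Filter Topology Finset

noncomputable def AA : Subalgebra ℚ ℝ := Algebra.adjoin ℚ
      ({Real.pi, Real.log 2, betaVal 2}
        ∪ {x : ℝ | ∃ k : ℕ, 1 ≤ k ∧ x = zetaVal (2 * k + 1)}
        ∪ {x : ℝ | ∃ k : ℕ, 2 ≤ k ∧ x = betaVal (2 * k)})

lemma hsc {ι : Type*} {f g : ι → ℝ} {a : ℝ} (h : HasSum f a) (e : ∀ n, g n = f n) : HasSum g a := by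
  have : g = f := funext e
  rwa [this]

lemma AA_rat (r : ℚ) : (r : ℝ) ∈ AA := by
  have := AA.algebraMap_mem r
  simpa using this

lemma AA_ratmul (r : ℚ) {x : ℝ} (hx : x ∈ AA) : (r : ℝ) * x ∈ AA := AA.mul_mem (AA_rat r) hx

lemma AA_pi : Real.pi ∈ AA := Algebra.subset_adjoin (by simp)
lemma AA_log : Real.log 2 ∈ AA := Algebra.subset_adjoin (by simp)

lemma zeta_hasSum (s : ℕ) (hs : 2 ≤ s) :
    HasSum (fun n : ℕ => 1 / ((n : ℝ) + 1) ^ s) (zetaVal s) := by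
  have h := (Real.summable_one_div_nat_pow (p := s)).2 (by omega)
  have h2 := (summable_nat_add_iff 1).2 h
  have h3 := h2.hasSum
  simpa [zetaVal] using h3

lemma zetaVal_mem (s : ℕ) (hs : 2 ≤ s) : zetaVal s ∈ AA := by
  rcases Nat.even_or_odd' s with ⟨k, rfl | rfl⟩
  · have h := hasSum_zeta_nat (k := k) (by omega)
    have h2 := (hasSum_nat_add_iff' 1).2 h
    have h3 := (zeta_hasSum (2 * k) hs).unique (by simpa using h2)
    have hk : 2 * k ≠ 0 := by omega
    rw [h3]
    have := AA_ratmul ((-1) ^ (k + 1) * 2 ^ (2 * k - 1) * bernoulli (2 * k) / ((2 * k).factorial : ℚ))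
      (AA.pow_mem AA_pi (2 * k))
    convert this using 1
    push_cast
    simp [show k ≠ 0 by omega]
    ring
  · exact Algebra.subset_adjoin (Or.inl (Or.inr ⟨k, by omega, rfl⟩))

lemma beta_hasSum (s : ℕ) (hs : 2 ≤ s) :
    HasSum (fun n : ℕ => (-1 : ℝ) ^ n / (2 * (n : ℝ) + 1) ^ s) (betaVal s) := by
  refine Summable.hasSum ?_
  refine Summable.of_norm_bounded (zeta_hasSum s hs).summable ?_
  intro n
  rw [norm_div, norm_pow, norm_neg, norm_one, one_pow, norm_pow, Real.norm_of_nonneg (by positivity)]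
  gcongr
  have : (0:ℝ) ≤ n := by positivity
  linarith

lemma betaVal_mem (s : ℕ) (hs : 2 ≤ s) : betaVal s ∈ AA := by
  rcases Nat.even_or_odd' s with ⟨k, rfl | rfl⟩
  · by_cases hk : k = 1
    · subst hk
      exact Algebra.subset_adjoin (by simp)
    · exact Algebra.subset_adjoin (Or.inr ⟨k, by omega, rfl⟩)
  · have h := hasSum_one_div_nat_pow_mul_sin (k := k) (by omega) (x := 1 / 4) (by norm_num)
    have he : HasSum (fun j : ℕ => 1 / ((2 * j : ℕ) : ℝ) ^ (2 * k + 1) *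
        Real.sin (2 * Real.pi * (2 * j : ℕ) * (1 / 4))) 0 := by
      convert hasSum_zero using 2 with j
      have : 2 * Real.pi * (2 * j : ℕ) * (1 / 4) = j * Real.pi := by push_cast; ring
      rw [this, Real.sin_nat_mul_pi, mul_zero]
    have ho : HasSum (fun j : ℕ => 1 / ((2 * j + 1 : ℕ) : ℝ) ^ (2 * k + 1) *
        Real.sin (2 * Real.pi * (2 * j + 1 : ℕ) * (1 / 4))) (betaVal (2 * k + 1)) := by
      convert beta_hasSum (2 * k + 1) hs using 2 with j
      have : 2 * Real.pi * (2 * j + 1 : ℕ) * (1 / 4) = Real.pi / 2 + j * Real.pi := by push_cast; ring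
      rw [this, Real.sin_add_nat_mul_pi, Real.sin_pi_div_two]
      push_cast
      ring
    have h3 := h.unique (he.even_add_odd ho)
    rw [zero_add] at h3
    rw [← h3]
    have hev : (Polynomial.map (algebraMap ℚ ℝ) (Polynomial.bernoulli (2 * k + 1))).eval (1 / 4 : ℝ)
        = (((Polynomial.bernoulli (2 * k + 1)).eval (1 / 4 : ℚ) : ℚ) : ℝ) := by
      have := Polynomial.eval_map_apply (f := algebraMap ℚ ℝ) (p := Polynomial.bernoulli (2 * k + 1)) (1/4 : ℚ)
      simpa using this
    rw [hev]
    have := AA_ratmul ((-1) ^ (k + 1) * 2 ^ (2 * k + 1) / 2 / ((2 * k + 1).factorial : ℚ) *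
      (Polynomial.bernoulli (2 * k + 1)).eval (1 / 4 : ℚ)) (AA.pow_mem AA_pi (2 * k + 1))
    convert this using 1
    push_cast
    ring

lemma odd_hasSum (s : ℕ) (hs : 2 ≤ s) :
    HasSum (fun n : ℕ => 1 / (2 * (n : ℝ) + 1) ^ s) (zetaVal s - (1 / 2) ^ s * zetaVal s) := by
  have h := zeta_hasSum s hs
  have he : HasSum (fun j : ℕ => 1 / (((2 * j + 1 : ℕ) : ℝ) + 1) ^ s) ((1 / 2) ^ s * zetaVal s) := by
    refine hsc (h.mul_left ((1 / 2 : ℝ) ^ s)) fun j => ?_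
    push_cast
    rw [show (2 * (j : ℝ) + 1 + 1) = 2 * (j + 1) by ring, mul_pow, one_div_pow]
    field_simp
  have hsum : Summable (fun j : ℕ => 1 / (((2 * j : ℕ) : ℝ) + 1) ^ s) :=
    h.summable.comp_injective (i := fun j : ℕ => 2 * j) (fun a b h => by simpa using h)
  have h2 := h.unique (HasSum.even_add_odd hsum.hasSum he)
  have h3 := hsum.hasSum
  rw [eq_sub_of_add_eq h2.symm] at h3
  convert h3 using 2 with j
  push_cast
  rfl

lemma zsum (τ : ℝ) (hτ : τ = 1 ∨ τ = -1) (i : ℕ) (hi : 2 ≤ i) :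
    ∃ l ∈ AA, HasSum (fun m : ℕ => τ ^ (m + 1) / ((m : ℝ) + 1) ^ i) l := by
  rcases hτ with rfl | rfl
  · exact ⟨_, zetaVal_mem i hi, by simpa using zeta_hasSum i hi⟩
  · refine ⟨-(zetaVal i - (1 / 2) ^ i * zetaVal i) + (1 / 2) ^ i * zetaVal i, ?_, ?_⟩
    · have := AA_ratmul (2 * (1 / 2) ^ i - 1) (zetaVal_mem i hi)
      convert this using 1
      push_cast
      ring
    · have he : HasSum (fun j : ℕ => (-1 : ℝ) ^ (2 * j + 1) / (((2 * j : ℕ) : ℝ) + 1) ^ i)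
          (-(zetaVal i - (1 / 2) ^ i * zetaVal i)) := by
        refine hsc ((odd_hasSum i hi).neg) fun j => ?_
        push_cast
        rw [pow_succ, pow_mul]
        ring
      refine HasSum.even_add_odd he ?_
      refine hsc ((zeta_hasSum i hi).mul_left ((1 / 2 : ℝ) ^ i)) fun j => ?_
      push_cast
      rw [show (2 * (j : ℝ) + 1 + 1) = 2 * (j + 1) by ring, mul_pow, one_div_pow,
        show 2 * j + 1 + 1 = 2 * (j + 1) by ring, pow_mul]
      simp
      field_simp

lemma lsum (τ : ℝ) (hτ : τ = 1 ∨ τ = -1) (j : ℕ) (hj : 2 ≤ j) :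
    ∃ l ∈ AA, HasSum (fun a : ℕ => τ ^ a / ((a : ℝ) + 1 / 2) ^ j) l := by
  have key : ∀ a : ℕ, ((a : ℝ) + 1 / 2) ^ j = (1 / 2) ^ j * (2 * (a : ℝ) + 1) ^ j := by
    intro a
    rw [← mul_pow]
    congr 1
    ring
  rcases hτ with rfl | rfl
  · refine ⟨2 ^ j * (zetaVal j - (1 / 2) ^ j * zetaVal j), ?_, ?_⟩
    · have := AA_ratmul (2 ^ j * (1 - (1 / 2) ^ j)) (zetaVal_mem j hj)
      convert this using 1
      push_cast
      ring
    · refine hsc ((odd_hasSum j hj).mul_left ((2 : ℝ) ^ j)) fun a => ?_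
      rw [key, one_div_pow]
      field_simp
      simp
  · refine ⟨2 ^ j * betaVal j, ?_, ?_⟩
    · have := AA_ratmul (2 ^ j) (betaVal_mem j hj)
      convert this using 1
      push_cast
      ring
    · refine hsc ((beta_hasSum j hj).mul_left ((2 : ℝ) ^ j)) fun a => ?_
      rw [key, one_div_pow]
      field_simp

lemma beta_one : Tendsto (fun M => ∑ a ∈ range M, (-1 : ℝ) ^ a / ((a : ℝ) + 1 / 2)) atTop
    (𝓝 (Real.pi / 2)) := by
  have h := Real.tendsto_sum_pi_div_four.const_mul 2
  convert h using 2 with M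
  · rw [mul_sum]
    refine sum_congr rfl fun a _ => ?_
    have : (0:ℝ) ≤ a := by positivity
    field_simp
  · ring

lemma harm_diff : Tendsto (fun M : ℕ => ((harmonic (2 * M) : ℚ) : ℝ) - ((harmonic M : ℚ) : ℝ)) atTop
    (𝓝 (Real.log 2)) := by
  have h := Real.tendsto_harmonic_sub_log
  have h2 := h.comp (tendsto_id.const_mul_atTop' (show 0 < 2 by norm_num))
  have h3 := (h2.sub h).add_const (Real.log 2)
  simp only [sub_self, zero_add] at h3
  refine h3.congr' ?_
  filter_upwards [eventually_gt_atTop 0] with M hM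
  have : (M : ℝ) ≠ 0 := by positivity
  simp only [Function.comp, id]
  push_cast
  rw [Real.log_mul (by norm_num) this]
  ring

lemma harm_sum (M : ℕ) : ∑ m ∈ range (2 * M), (-1 : ℝ) ^ (m + 1) / ((m : ℝ) + 1) =
    -(((harmonic (2 * M) : ℚ) : ℝ) - ((harmonic M : ℚ) : ℝ)) := by
  induction M with
  | zero => simp
  | succ M ih =>
    rw [show 2 * (M + 1) = 2 * M + 1 + 1 by ring, sum_range_succ, sum_range_succ, ih,
      harmonic_succ, harmonic_succ, harmonic_succ]
    push_cast
    have hpow : (-1 : ℝ) ^ (2 * M) = 1 := by rw [pow_mul, neg_one_sq, one_pow]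
    simp only [pow_succ, hpow]
    have : (0:ℝ) ≤ M := by positivity
    field_simp
    simp
    ring

lemma harm_sum2 (M : ℕ) : ∑ m ∈ range M, (1 / ((m : ℝ) + 1 / 2) - 1 / ((m : ℝ) + 1)) =
    2 * (((harmonic (2 * M) : ℚ) : ℝ) - ((harmonic M : ℚ) : ℝ)) := by
  induction M with
  | zero => simp
  | succ M ih =>
    rw [sum_range_succ, ih, show 2 * (M + 1) = 2 * M + 1 + 1 by ring, 
      harmonic_succ, harmonic_succ, harmonic_succ]
    push_cast
    have : (0:ℝ) ≤ M := by positivity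
    field_simp
    ring

lemma log_tend2 : Tendsto (fun M => ∑ m ∈ range M, (1 / ((m : ℝ) + 1 / 2) - 1 / ((m : ℝ) + 1))) atTop
    (𝓝 (2 * Real.log 2)) := by
  simp_rw [harm_sum2]
  exact harm_diff.const_mul 2

lemma log_tend : Tendsto (fun M => ∑ m ∈ range M, (-1 : ℝ) ^ (m + 1) / ((m : ℝ) + 1)) atTop
    (𝓝 (-Real.log 2)) := by
  obtain ⟨l, hl⟩ : ∃ l, Tendsto (fun n ↦ ∑ i ∈ range n, (-1 : ℝ) ^ i * (1 / ((i : ℝ) + 1))) atTop (𝓝 l) := by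
    apply Antitone.tendsto_alternating_series_of_tendsto_zero
    · intro a b h
      dsimp only
      gcongr
    · exact tendsto_one_div_add_atTop_nhds_zero_nat
  have hl' : Tendsto (fun M => ∑ m ∈ range M, (-1 : ℝ) ^ (m + 1) / ((m : ℝ) + 1)) atTop (𝓝 (-l)) := by
    convert hl.neg using 2 with M
    rw [← sum_neg_distrib]
    refine sum_congr rfl fun a _ => ?_
    ring
  have h2 := hl'.comp (tendsto_id.const_mul_atTop' (show 0 < 2 by norm_num))
  have h3 := h2.congr (fun M => by simp only [Function.comp, id]; exact harm_sum M)
  have := tendsto_nhds_unique h3 harm_diff.neg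
  rwa [this] at hl'


noncomputable def XX (n : ℤ) : ℝ := (n : ℝ) + 1 / 2

lemma XX_abs (n : ℤ) : 1 / 2 ≤ |XX n| := by
  unfold XX
  rcases le_or_gt 0 n with h | h
  · have : (0 : ℝ) ≤ n := by exact_mod_cast h
    rw [abs_of_nonneg] <;> linarith
  · have : (n : ℝ) ≤ -1 := by exact_mod_cast (by omega : n ≤ -1)
    rw [abs_of_neg] <;> linarith

lemma XX_pos (n : ℤ) : 0 < |XX n| := lt_of_lt_of_le (by norm_num) (XX_abs n)

lemma XX_ne (n : ℤ) : XX n ≠ 0 := abs_pos.1 (XX_pos n)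

lemma XX_add (n m : ℤ) : XX (n + m) = XX n + m := by unfold XX; push_cast; ring

lemma XX_neg (n : ℤ) : XX (-(n + 1)) = -XX n := by unfold XX; push_cast; ring

lemma XX_nat (n : ℕ) : XX n = (n : ℝ) + 1 / 2 := by unfold XX; push_cast; ring

lemma XX_inv (n : ℤ) : |XX n|⁻¹ ≤ 2 := by
  rw [inv_le_comm₀ (XX_pos n) (by norm_num)]
  have := XX_abs n
  linarith

lemma summ_X {s : ℝ} (hs : 1 < s) : Summable (fun n : ℤ => 1 / |XX n| ^ s) :=
  (Real.summable_one_div_int_add_rpow (1 / 2) s).2 hs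

lemma summ_X2 : Summable (fun n : ℤ => (|XX n|⁻¹) ^ 2) := by
  have := summ_X (s := 2) (by norm_num)
  refine this.congr fun n => ?_
  simp

lemma sgn_abs {σ : ℝ} (h : σ = 1 ∨ σ = -1) (n : ℤ) : |σ ^ n| = 1 := by
  rw [abs_zpow]
  rcases h with rfl | rfl <;> simp

lemma sgn_ne {σ : ℝ} (h : σ = 1 ∨ σ = -1) : σ ≠ 0 := by
  rcases h with rfl | rfl <;> simp

lemma sgn_sq {σ : ℝ} (h : σ = 1 ∨ σ = -1) : σ * σ = 1 := by
  rcases h with rfl | rfl <;> simp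

lemma sgn_neg {σ : ℝ} (h : σ = 1 ∨ σ = -1) (n : ℤ) : σ ^ (-n) = σ ^ n := by
  rcases h with rfl | rfl
  · simp
  · rw [zpow_neg, ← inv_zpow]
    norm_num

noncomputable def cterm (σ : ℝ) (p q : ℕ) (m : ℤ) (n : ℤ) : ℝ := σ ^ n / (XX n ^ p * XX (n + m) ^ q)

noncomputable def CC (σ : ℝ) (p q : ℕ) (m : ℤ) : ℝ := ∑' n : ℤ, cterm σ p q m n

lemma pow_bound {u v : ℝ} (hu : 0 ≤ u) (hv : 0 ≤ v) (hu2 : u ≤ 2) (hv2 : v ≤ 2) (p q : ℕ)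
    (h : 2 ≤ p + q) : u ^ p * v ^ q ≤ 2 ^ (p + q) * (u ^ 2 + v ^ 2) := by
  have hw : 0 ≤ max u v := le_trans hu (le_max_left _ _)
  calc u ^ p * v ^ q ≤ (max u v) ^ p * (max u v) ^ q := by
        gcongr
        · exact le_max_left _ _
        · exact le_max_right _ _
    _ = (max u v) ^ (p + q - 2) * (max u v) ^ 2 := by
        rw [← pow_add, ← pow_add]
        congr 1
        omega
    _ ≤ 2 ^ (p + q) * (u ^ 2 + v ^ 2) := by
        gcongr
        · calc (max u v) ^ (p + q - 2) ≤ 2 ^ (p + q - 2) := by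
                gcongr
                exact max_le hu2 hv2
            _ ≤ 2 ^ (p + q) := pow_le_pow_right₀ (by norm_num) (by omega)
        · rcases max_choice u v with h | h <;> rw [h] <;> nlinarith [sq_nonneg u, sq_nonneg v]

lemma cterm_abs {σ : ℝ} (h : σ = 1 ∨ σ = -1) (p q : ℕ) (m n : ℤ) :
    |cterm σ p q m n| = (|XX n|⁻¹) ^ p * (|XX (n + m)|⁻¹) ^ q := by
  unfold cterm
  rw [abs_div, sgn_abs h, abs_mul, abs_pow, abs_pow, one_div, mul_inv, inv_pow, inv_pow]

lemma cterm_summ {σ : ℝ} (h : σ = 1 ∨ σ = -1) (p q : ℕ) (hpq : 2 ≤ p + q) (m : ℤ) :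
    Summable (cterm σ p q m) := by
  have h2 : Summable (fun n : ℤ => (|XX (n + m)|⁻¹) ^ 2) :=
    summ_X2.comp_injective (add_left_injective m)
  refine Summable.of_norm_bounded ((summ_X2.add h2).mul_left (2 ^ (p + q))) fun n => ?_
  rw [Real.norm_eq_abs, cterm_abs h]
  have := XX_pos n
  have := XX_pos (n + m)
  exact pow_bound (by positivity) (by positivity) (XX_inv _) (XX_inv _) p q hpq

lemma CC_rec {σ : ℝ} (h : σ = 1 ∨ σ = -1) (p q : ℕ) (hpq : 1 ≤ p + q) (m : ℤ) (hm : m ≠ 0) :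
    CC σ (p + 1) (q + 1) m = (CC σ (p + 1) q m - CC σ p (q + 1) m) / m := by
  unfold CC
  rw [← Summable.tsum_sub (cterm_summ h _ _ (by omega) m) (cterm_summ h _ _ (by omega) m),
    ← tsum_div_const]
  refine tsum_congr fun n => ?_
  unfold cterm
  have h1 := XX_ne n
  have h2 := XX_ne (n + m)
  have h3 : (m : ℝ) ≠ 0 := by exact_mod_cast hm
  have h4 : (m : ℝ) = XX (n + m) - XX n := by rw [XX_add]; ring
  rw [h4] at h3 ⊢
  field_simp
  ring

lemma CC_q0 {σ : ℝ} (p : ℕ) (m : ℤ) : CC σ p 0 m = CC σ p 0 0 := by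
  simp [CC, cterm]

lemma CC_p0 {σ : ℝ} (h : σ = 1 ∨ σ = -1) (q : ℕ) (m : ℤ) : CC σ 0 q m = σ ^ m * CC σ q 0 0 := by
  unfold CC
  rw [← (Equiv.addRight m).tsum_eq (cterm σ q 0 0), ← tsum_mul_left]
  refine tsum_congr fun n => ?_
  simp only [cterm, Equiv.coe_addRight]
  rw [zpow_add₀ (sgn_ne h)]
  have : σ ^ m * σ ^ m = 1 := by
    rw [← mul_zpow, sgn_sq h, one_zpow]
  field_simp
  ring_nf
  rw [pow_two, this]
  ring

lemma CC_diag {σ : ℝ} (p q : ℕ) : CC σ p q 0 = CC σ (p + q) 0 0 := by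
  simp [CC, cterm, pow_add]

/-- two-sided single sums lie in the algebra -/
lemma CC_mem {σ : ℝ} (h : σ = 1 ∨ σ = -1) (p : ℕ) (hp : 2 ≤ p) : CC σ p 0 0 ∈ AA := by
  obtain ⟨l, hl, hs⟩ := lsum σ h p hp
  have h1 : HasSum (fun n : ℕ => cterm σ p 0 0 n) l := by
    refine hsc hs fun n => ?_
    simp [cterm, XX_nat]
  have h2 : HasSum (fun n : ℕ => cterm σ p 0 0 (-(n + 1))) ((-1) ^ p * σ * l) := by
    refine hsc (hs.mul_left ((-1) ^ p * σ)) fun n => ?_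
    simp only [cterm]
    rw [XX_neg, sgn_neg h, zpow_add₀ (sgn_ne h), neg_pow, XX_nat]
    have h1 : (-1 : ℝ) ^ p * (-1) ^ p = 1 := by rw [← mul_pow]; simp
    have h2 : (-1 : ℝ) ^ p ≠ 0 := by simp
    simp
    field_simp
    rw [pow_two, h1, mul_one]
  have h3 := (h1.of_nat_of_neg_add_one h2).tsum_eq
  unfold CC
  rw [h3]
  refine AA.add_mem hl ?_
  rcases h with rfl | rfl
  · have := AA_ratmul ((-1) ^ p) hl
    push_cast at this
    simpa using this
  · have := AA_ratmul ((-1) ^ p * (-1)) hl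
    push_cast at this
    simpa using this

noncomputable def DD (σ : ℝ) (m : ℕ) : ℝ := ∑' n : ℤ, σ ^ n * (1 / XX n - 1 / XX (n + m))

lemma DD_eq (σ : ℝ) (m n : ℤ) :
    σ ^ n * (1 / XX n - 1 / XX (n + m)) = m * cterm σ 1 1 m n := by
  unfold cterm
  have h1 := XX_ne n
  have h2 := XX_ne (n + m)
  have h4 : (m : ℝ) = XX (n + m) - XX n := by rw [XX_add]; ring
  rw [h4]
  field_simp

lemma DD_summ {σ : ℝ} (h : σ = 1 ∨ σ = -1) (m : ℤ) :
    Summable fun n : ℤ => σ ^ n * (1 / XX n - 1 / XX (n + m)) := by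
  refine ((cterm_summ h 1 1 (by omega) m).mul_left (m : ℝ)).congr fun n => ?_
  rw [DD_eq]

lemma DD_CC {σ : ℝ} (m : ℕ) : DD σ m = m * CC σ 1 1 m := by
  unfold DD CC
  rw [← tsum_mul_left]
  refine tsum_congr fun n => ?_
  rw [DD_eq]
  push_cast
  rfl

lemma DD_succ {σ : ℝ} (h : σ = 1 ∨ σ = -1) (m : ℕ) : DD σ (m + 1) = DD σ m + σ ^ m * DD σ 1 := by
  unfold DD
  rw [← (Equiv.addRight (m : ℤ)).tsum_eq (fun n : ℤ => σ ^ n * (1 / XX n - 1 / XX (n + (1 : ℕ)))),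
    ← tsum_mul_left, ← Summable.tsum_add (DD_summ h m)]
  · refine tsum_congr fun n => ?_
    simp only [Equiv.coe_addRight]
    rw [zpow_add₀ (sgn_ne h), zpow_natCast]
    have : σ ^ m * σ ^ m = 1 := by
      rw [← mul_pow, sgn_sq h, one_pow]
    push_cast
    rw [add_assoc]
    linear_combination (-σ ^ n * (1 / XX (n + m) - 1 / XX (n + (m + 1)))) * this
  · have := (DD_summ h 1).comp_injective (add_left_injective (m : ℤ))
    exact this.mul_left _

lemma DD_term {σ : ℝ} (h : σ = 1 ∨ σ = -1) (n : ℕ) :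
    σ ^ (n : ℤ) * (1 / XX n - 1 / XX ((n : ℤ) + 1)) +
    σ ^ (-((n : ℤ) + 1)) * (1 / XX (-((n : ℤ) + 1)) - 1 / XX (-((n : ℤ) + 1) + 1)) =
    σ ^ n * (1 / ((n : ℝ) + 1 / 2) - 1 / ((n : ℝ) + 3 / 2)) +
    σ * σ ^ n * (1 / ((n : ℝ) - 1 / 2) - 1 / ((n : ℝ) + 1 / 2)) := by
  rw [sgn_neg h, zpow_add₀ (sgn_ne h), zpow_natCast, zpow_one, XX_neg]
  have e1 : XX ((n : ℤ) + 1) = (n : ℝ) + 3 / 2 := by unfold XX; push_cast; ring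
  have e2 : XX (-((n : ℤ) + 1) + 1) = -((n : ℝ) - 1 / 2) := by unfold XX; push_cast; ring
  rw [e1, e2, XX_nat, div_neg, div_neg]
  ring

lemma DD1_tend {σ : ℝ} (h : σ = 1 ∨ σ = -1) :
    Tendsto (fun N : ℕ => ∑ n ∈ range N, (σ ^ n * (1 / ((n : ℝ) + 1 / 2) - 1 / ((n : ℝ) + 3 / 2)) +
    σ * σ ^ n * (1 / ((n : ℝ) - 1 / 2) - 1 / ((n : ℝ) + 1 / 2)))) atTop (𝓝 (DD σ 1)) := by
  have hsum := DD_summ h 1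
  have hinj : Function.Injective (fun n : ℕ => -((n : ℤ) + 1)) := fun a b h => by
    have : -((a : ℤ) + 1) = -((b : ℤ) + 1) := h
    omega
  have s1 := hsum.comp_injective (i := fun n : ℕ => (n : ℤ)) Nat.cast_injective
  have s2 := hsum.comp_injective hinj
  have e : DD σ 1 = _ := tsum_of_nat_of_neg_add_one s1 s2
  rw [e]
  refine (s1.hasSum.tendsto_sum_nat.add s2.hasSum.tendsto_sum_nat).congr fun N => ?_
  rw [← sum_add_distrib]
  refine sum_congr rfl fun n _ => ?_
  exact DD_term h n

lemma half_tend (c : ℝ) : Tendsto (fun N : ℕ => 1 / ((N : ℝ) + c)) atTop (𝓝 0) := by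
  simp_rw [one_div]
  exact tendsto_inv_atTop_zero.comp (tendsto_atTop_add_const_right _ c tendsto_natCast_atTop_atTop)

lemma nat_half_ne (n : ℕ) : (n : ℝ) - 1 / 2 ≠ 0 := by
  have := XX_ne ((n : ℤ) - 1)
  unfold XX at this
  push_cast at this
  intro h
  apply this
  linarith

lemma DD_one_pos : DD 1 1 = 0 := by
  refine tendsto_nhds_unique (DD1_tend (Or.inl rfl)) ?_
  have h3 := ((half_tend (-(1 / 2))).add (half_tend (1 / 2))).neg
  rw [add_zero, neg_zero] at h3
  refine h3.congr fun N => ?_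
  induction N with
  | zero => norm_num
  | succ N ih =>
    rw [sum_range_succ, ← ih]
    push_cast
    rw [show (N : ℝ) + 1 + -(1 / 2) = N + 1 / 2 by ring, show (N : ℝ) + 1 + (1 / 2) = N + 3 / 2 by ring,
      show (N : ℝ) + -(1 / 2) = N - 1 / 2 by ring]
    simp only [one_pow]
    ring

lemma alt_tend {f : ℕ → ℝ} (hf : Tendsto f atTop (𝓝 0)) :
    Tendsto (fun N => (-1 : ℝ) ^ N * f N) atTop (𝓝 0) := by
  rw [tendsto_zero_iff_abs_tendsto_zero] at hf ⊢
  refine hf.congr fun N => ?_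
  simp [abs_mul]

lemma DD_one_neg : DD (-1) 1 = 2 * Real.pi := by
  refine tendsto_nhds_unique (DD1_tend (Or.inr rfl)) ?_
  have h3 := alt_tend (by simpa using (half_tend (1 / 2)).add (half_tend (-(1 / 2))))
  have h4 := (beta_one.const_mul 4).add h3
  rw [add_zero, show 4 * (Real.pi / 2) = 2 * Real.pi by ring] at h4
  refine h4.congr fun N => ?_
  induction N with
  | zero => norm_num
  | succ N ih =>
    rw [sum_range_succ, sum_range_succ, ← ih]
    simp only [one_div]
    push_cast
    rw [show (N : ℝ) + 1 + -(2⁻¹) = N + 2⁻¹ by ring, show (N : ℝ) + 1 + (2⁻¹) = N + 3 / 2 by ring,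
      show (N : ℝ) + -(2⁻¹) = N - 2⁻¹ by ring, pow_succ]
    ring

lemma DD_form {σ : ℝ} (h : σ = 1 ∨ σ = -1) :
    ∃ c ∈ AA, ∀ m : ℕ, DD σ m = c * (1 - σ ^ m) := by
  rcases h with rfl | rfl
  · refine ⟨0, AA.zero_mem, fun m => ?_⟩
    induction m with
    | zero => simp [DD]
    | succ m ih => rw [DD_succ (Or.inl rfl), ih, DD_one_pos]; simp
  · refine ⟨Real.pi, AA_pi, fun m => ?_⟩
    induction m with
    | zero => simp [DD]
    | succ m ih => rw [DD_succ (Or.inr rfl), ih, DD_one_neg, pow_succ]; ring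

inductive IS (σ : ℝ) : ℕ → (ℕ → ℝ) → Prop
  | gen (k i : ℕ) (hi : k ≤ i) (τ : ℝ) (hτ : τ = 1 ∨ τ = σ) (c : ℝ) (hc : c ∈ AA) :
      IS σ k (fun m => c * (τ ^ (m + 1) / ((m : ℝ) + 1) ^ i))
  | add (k : ℕ) (f g : ℕ → ℝ) (hf : IS σ k f) (hg : IS σ k g) : IS σ k (fun m => f m + g m)

lemma IS.neg {σ : ℝ} {k : ℕ} {f : ℕ → ℝ} (h : IS σ k f) : IS σ k (fun m => -f m) := by
  induction h with
  | gen i hi τ hτ c hc =>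
    have := IS.gen (σ := σ) k i hi τ hτ (-c) (AA.neg_mem hc)
    simpa using this
  | add f g hf hg ihf ihg =>
    have := IS.add k _ _ ihf ihg
    convert this using 2 with m
    ring

lemma IS.sub {σ : ℝ} {k : ℕ} {f g : ℕ → ℝ} (h : IS σ k f) (h' : IS σ k g) :
    IS σ k (fun m => f m - g m) := by
  simpa [sub_eq_add_neg] using IS.add k _ _ h h'.neg

lemma IS.div {σ : ℝ} {k : ℕ} {f : ℕ → ℝ} (h : IS σ k f) : IS σ (k + 1) (fun m => f m / ((m : ℝ) + 1)) := by
  induction h with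
  | gen i hi τ hτ c hc =>
    have := IS.gen (σ := σ) (k + 1) (i + 1) (by omega) τ hτ c hc
    convert this using 2 with m
    have : (m : ℝ) + 1 ≠ 0 := by positivity
    field_simp
    try ring
  | add f g hf hg ihf ihg =>
    have := IS.add _ _ _ ihf ihg
    convert this using 2 with m
    ring

lemma IS.mono {σ : ℝ} {k l : ℕ} {f : ℕ → ℝ} (h : IS σ k f) (hl : l ≤ k) : IS σ l f := by
  induction h with
  | gen i hi τ hτ c hc => exact IS.gen l i (by omega) τ hτ c hc
  | add f g hf hg ihf ihg => exact IS.add _ _ _ ihf ihg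

lemma IS_q0 {σ : ℝ} (h : σ = 1 ∨ σ = -1) (p : ℕ) (hp : 2 ≤ p) :
    IS σ 0 (fun m => CC σ p 0 ((m + 1 : ℕ) : ℤ)) := by
  have := IS.gen (σ := σ) 0 0 le_rfl 1 (Or.inl rfl) _ (CC_mem h p hp)
  convert this using 2 with m
  rw [CC_q0]
  simp

lemma IS_p0 {σ : ℝ} (h : σ = 1 ∨ σ = -1) (p : ℕ) (hp : 2 ≤ p) :
    IS σ 0 (fun m => CC σ 0 p ((m + 1 : ℕ) : ℤ)) := by
  have := IS.gen (σ := σ) 0 0 le_rfl σ (Or.inr rfl) _ (CC_mem h p hp)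
  convert this using 2 with m
  rw [CC_p0 h, zpow_natCast]
  simp
  ring

lemma IS_one {σ : ℝ} (h : σ = 1 ∨ σ = -1) (w : ℕ) : ∀ p q : ℕ, p + q = w →
    IS σ 1 (fun m => CC σ (p + 1) (q + 1) ((m + 1 : ℕ) : ℤ)) := by
  induction w with
  | zero =>
    intro p q hpq
    obtain ⟨rfl, rfl⟩ : p = 0 ∧ q = 0 := by omega
    obtain ⟨c, hc, hD⟩ := DD_form h
    have h1 := IS.gen (σ := σ) 1 1 le_rfl 1 (Or.inl rfl) _ hc
    have h2 := IS.gen (σ := σ) 1 1 le_rfl σ (Or.inr rfl) _ hc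
    convert h1.sub h2 using 2 with m
    have h3 := hD (m + 1)
    rw [DD_CC] at h3
    push_cast at h3 ⊢
    have : (m : ℝ) + 1 ≠ 0 := by positivity
    rw [one_pow, pow_one, ← mul_sub, ← sub_div, mul_div_assoc', ← h3]
    field_simp
  | succ w ih =>
    intro p q hpq
    have key : IS σ 0 (fun m => CC σ (p + 1) q ((m + 1 : ℕ) : ℤ) - CC σ p (q + 1) ((m + 1 : ℕ) : ℤ)) := by
      refine IS.sub ?_ ?_
      · rcases q with _ | q
        · exact IS_q0 h _ (by omega)
        · exact (ih p q (by omega)).mono (by omega)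
      · rcases p with _ | p
        · exact IS_p0 h _ (by omega)
        · exact (ih p q (by omega)).mono (by omega)
    convert key.div using 2 with m
    rw [CC_rec h _ _ (by omega) _ (by omega)]
    push_cast
    rfl

lemma IS_two {σ : ℝ} (h : σ = 1 ∨ σ = -1) (p q : ℕ) :
    IS σ 2 (fun m => CC σ (p + 2) (q + 2) ((m + 1 : ℕ) : ℤ)) := by
  convert ((IS_one h _ (p + 1) q rfl).sub (IS_one h _ p (q + 1) rfl)).div using 2 with m
  rw [CC_rec h _ _ (by omega) _ (by omega)]
  push_cast
  rfl

lemma IS_two' {σ : ℝ} (h : σ = 1 ∨ σ = -1) (p : ℕ) :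
    IS σ 2 (fun m => CC σ (p + 2) 1 ((m + 1 : ℕ) : ℤ) - CC σ (p + 2) 0 0 / ((m : ℝ) + 1)) := by
  convert (IS_one h _ p 0 rfl).neg.div using 2 with m
  rw [CC_rec h (p + 1) 0 (by omega) _ (by omega), CC_q0]
  push_cast
  ring

lemma IS_tend {σ τ : ℝ} (h : σ = 1 ∨ σ = -1) (hτ : τ = 1 ∨ τ = -1) {f : ℕ → ℝ} {k : ℕ} (hf : IS σ k f)
    (hk : 2 ≤ k) :
    ∃ l ∈ AA, Tendsto (fun M => ∑ m ∈ range M, τ ^ (m + 1) * f m) atTop (𝓝 l) := by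
  induction hf with
  | gen i hi ρ hρ c hc =>
    have : τ * ρ = 1 ∨ τ * ρ = -1 := by
      rcases h with rfl | rfl <;> rcases hτ with rfl | rfl <;> rcases hρ with rfl | rfl <;> simp
    obtain ⟨l, hl, hs⟩ := zsum _ this i (by omega)
    refine ⟨c * l, AA.mul_mem hc hl, ?_⟩
    refine (hs.tendsto_sum_nat.const_mul c).congr fun M => ?_
    rw [mul_sum]
    refine sum_congr rfl fun m _ => ?_
    rw [mul_pow]
    ring
  | add f g hf hg ihf ihg =>
    obtain ⟨l, hl, hs⟩ := ihf
    obtain ⟨l', hl', hs'⟩ := ihg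
    refine ⟨l + l', AA.add_mem hl hl', ?_⟩
    refine (hs.add hs').congr fun M => ?_
    rw [← sum_add_distrib]
    refine sum_congr rfl fun m _ => ?_
    ring

/-- the right-hand side converges to an element of the algebra -/
lemma rhs_tend {σ1 σ2 : ℝ} (h1 : σ1 = 1 ∨ σ1 = -1) (h2 : σ2 = 1 ∨ σ2 = -1) (p q : ℕ) (hp : 2 ≤ p)
    (hq : 1 ≤ q) : ∃ l ∈ AA, Tendsto (fun M => CC (σ1 * σ2) p q 0 +
      ∑ m ∈ range M, σ2 ^ (m + 1) * CC (σ1 * σ2) p q ((m + 1 : ℕ) : ℤ) -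
      (∑ m ∈ range M, σ2 ^ m / ((m : ℝ) + 1 / 2) ^ q) * CC σ1 p 0 0) atTop (𝓝 l) := by
  have h12 : σ1 * σ2 = 1 ∨ σ1 * σ2 = -1 := by
    rcases h1 with rfl | rfl <;> rcases h2 with rfl | rfl <;> simp
  have hd : CC (σ1 * σ2) p q 0 ∈ AA := by
    rw [CC_diag]
    exact CC_mem h12 _ (by omega)
  obtain ⟨p, rfl⟩ : ∃ p', p = p' + 2 := ⟨p - 2, by omega⟩
  obtain ⟨q, rfl⟩ : ∃ q', q = q' + 1 := ⟨q - 1, by omega⟩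
  rcases q with _ | q
  · obtain ⟨l, hl, ht⟩ := IS_tend h12 h2 (IS_two' h12 p) le_rfl
    simp only [zero_add, pow_one] at *
    rcases h2 with rfl | rfl
    · refine ⟨_, ?_, ((ht.const_add (CC (σ1 * 1) (p + 2) 1 0)).sub (log_tend2.mul_const (CC σ1 (p + 2) 0 0))).congr
        fun M => ?_⟩
      · refine AA.sub_mem (AA.add_mem hd hl) (AA.mul_mem ?_ (CC_mem h1 _ (by omega)))
        have := AA_ratmul 2 AA_log
        simpa using this
      · simp only [mul_one, one_pow, one_mul, sum_sub_distrib]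
        have : ∑ x ∈ range M, CC σ1 (p + 2) 0 0 / ((x : ℝ) + 1) =
          (∑ x ∈ range M, 1 / ((x : ℝ) + 1)) * CC σ1 (p + 2) 0 0 := by
          rw [sum_mul]
          refine sum_congr rfl fun m _ => ?_
          ring
        rw [this]
        ring
    · refine ⟨_, ?_, (((ht.const_add (CC (σ1 * (-1)) (p + 2) 1 0)).add
        (log_tend.mul_const (CC (σ1 * (-1)) (p + 2) 0 0))).sub
        (beta_one.mul_const (CC σ1 (p + 2) 0 0))).congr fun M => ?_⟩
      · refine AA.sub_mem (AA.add_mem (AA.add_mem hd hl) (AA.mul_mem (AA.neg_mem AA_log)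
          (CC_mem h12 _ (by omega)))) (AA.mul_mem ?_ (CC_mem h1 _ (by omega)))
        have := AA_ratmul (1 / 2) AA_pi
        convert this using 1
        push_cast
        ring
      · simp only [mul_sub, sum_sub_distrib]
        have : ∑ x ∈ range M, (-1 : ℝ) ^ (x + 1) * (CC (σ1 * -1) (p + 2) 0 0 / ((x : ℝ) + 1)) =
          (∑ x ∈ range M, (-1 : ℝ) ^ (x + 1) / ((x : ℝ) + 1)) * CC (σ1 * -1) (p + 2) 0 0 := by
          rw [sum_mul]
          refine sum_congr rfl fun m _ => ?_
          ring
        rw [this]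
        ring
  · obtain ⟨l, hl, ht⟩ := IS_tend h12 h2 (IS_two h12 p q) le_rfl
    obtain ⟨l', hl', ht'⟩ := lsum σ2 h2 (q + 1 + 1) (by omega)
    exact ⟨_, AA.sub_mem (AA.add_mem hd hl) (AA.mul_mem hl' (CC_mem h1 _ (by omega))),
      (ht.const_add _).sub (ht'.tendsto_sum_nat.mul_const _)⟩

noncomputable def ee (σ : ℝ) (q : ℕ) (k : ℤ) : ℝ := σ ^ k / XX k ^ q

noncomputable def ZZ : ℝ := ∑' n : ℤ, (|XX n|⁻¹) ^ 2

lemma window (c : ℤ) (N : ℕ) : ∑ i ∈ range N, |XX (c + i)|⁻¹ ≤ √ZZ * √N := by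
  have hZ : 0 ≤ ZZ := tsum_nonneg fun n => sq_nonneg _
  rw [← Real.sqrt_mul hZ]
  refine Real.le_sqrt_of_sq_le ?_
  refine (sq_sum_le_card_mul_sum_sq).trans ?_
  rw [card_range, mul_comm]
  gcongr
  have hinj : Function.Injective (fun i : ℕ => c + (i : ℤ)) := fun a b h => by
    have : c + (a : ℤ) = c + b := h
    omega
  have := summ_X2.sum_le_tsum ((range N).map ⟨_, hinj⟩) (fun n _ => sq_nonneg _)
  rw [sum_map] at this
  exact this

lemma ee_abs {σ : ℝ} (h : σ = 1 ∨ σ = -1) (q : ℕ) (hq : 1 ≤ q) (k : ℤ) :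
    |ee σ q k| ≤ 2 ^ q * |XX k|⁻¹ := by
  unfold ee
  rw [abs_div, sgn_abs h, abs_pow, one_div, ← inv_pow]
  have h1 := XX_pos k
  have h2 := XX_inv k
  obtain ⟨q, rfl⟩ : ∃ q', q = q' + 1 := ⟨q - 1, by omega⟩
  rw [pow_succ]
  gcongr
  calc (|XX k|⁻¹) ^ q ≤ 2 ^ q := by gcongr
    _ ≤ 2 ^ (q + 1) := pow_le_pow_right₀ (by norm_num) (by omega)

lemma window_ee {σ : ℝ} (h : σ = 1 ∨ σ = -1) (q : ℕ) (hq : 1 ≤ q) (c : ℤ) (N : ℕ) :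
    ∑ i ∈ range N, |ee σ q (c + i)| ≤ 2 ^ q * (√ZZ * √N) := by
  calc ∑ i ∈ range N, |ee σ q (c + i)| ≤ ∑ i ∈ range N, 2 ^ q * |XX (c + i)|⁻¹ :=
        sum_le_sum fun i _ => ee_abs h q hq _
    _ = 2 ^ q * ∑ i ∈ range N, |XX (c + i)|⁻¹ := by rw [mul_sum]
    _ ≤ _ := by gcongr; exact window c N

noncomputable def RR (σ : ℝ) (q M : ℕ) (n : ℤ) : ℝ :=
  ∑ m ∈ range (M + 1), ee σ q (n + m) - ∑ m ∈ range M, ee σ q m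

lemma RR_pos (σ : ℝ) (q M a : ℕ) : RR σ q M a =
    ∑ i ∈ range (a + 1), ee σ q (M + i) - ∑ i ∈ range a, ee σ q (0 + i) := by
  have h1 := sum_range_add (fun i : ℕ => ee σ q (i : ℤ)) a (M + 1)
  have h2 := sum_range_add (fun i : ℕ => ee σ q (i : ℤ)) M (a + 1)
  rw [show M + (a + 1) = a + (M + 1) by ring, h1] at h2
  unfold RR
  push_cast at h2
  simp only [zero_add]
  linarith

lemma RR_neg (σ : ℝ) (q M a : ℕ) : RR σ q M (-((a : ℤ) + 1)) =
    ∑ i ∈ range (a + 1), ee σ q (-((a : ℤ) + 1) + i) - ∑ i ∈ range a, ee σ q ((M : ℤ) - a + i) := by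
  have h1 := sum_range_add (fun i : ℕ => ee σ q (-((a : ℤ) + 1) + i)) (M + 1) a
  have h2 := sum_range_add (fun i : ℕ => ee σ q (-((a : ℤ) + 1) + i)) (a + 1) M
  rw [show a + 1 + M = M + 1 + a by ring, h1] at h2
  unfold RR
  have e1 : ∀ i : ℕ, -((a : ℤ) + 1) + ((M + 1 + i : ℕ) : ℤ) = (M : ℤ) - a + i := by
    intro i; push_cast; ring
  have e2 : ∀ i : ℕ, -((a : ℤ) + 1) + ((a + 1 + i : ℕ) : ℤ) = i := by
    intro i; push_cast; ring
  simp only [e1, e2] at h2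
  linarith

lemma int_cases (n : ℤ) : (∃ a : ℕ, n = a) ∨ ∃ a : ℕ, n = -((a : ℤ) + 1) := by
  rcases le_or_gt 0 n with h | h
  · exact Or.inl ⟨n.toNat, by omega⟩
  · exact Or.inr ⟨(-n - 1).toNat, by omega⟩

lemma RR_bound {σ : ℝ} (h : σ = 1 ∨ σ = -1) (q : ℕ) (hq : 1 ≤ q) (M : ℕ) (n : ℤ) :
    |RR σ q M n| ≤ 2 * 2 ^ q * √ZZ * √2 * √|XX n| := by
  have aux : ∀ (c d : ℤ) (a : ℕ), |∑ i ∈ range (a + 1), ee σ q (c + i) - ∑ i ∈ range a, ee σ q (d + i)| ≤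
      2 * 2 ^ q * √ZZ * √2 * √((a : ℝ) + 1 / 2) := by
    intro c d a
    have h1 := window_ee h q hq c (a + 1)
    have h2 := window_ee h q hq d a
    have h3 : √((a + 1 : ℕ) : ℝ) ≤ √2 * √((a : ℝ) + 1 / 2) := by
      rw [← Real.sqrt_mul (by norm_num)]
      apply Real.sqrt_le_sqrt
      push_cast
      have : (0 : ℝ) ≤ a := by positivity
      linarith
    have h4 : √(a : ℝ) ≤ √2 * √((a : ℝ) + 1 / 2) := by
      rw [← Real.sqrt_mul (by norm_num)]
      apply Real.sqrt_le_sqrt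
      have : (0 : ℝ) ≤ a := by positivity
      linarith
    calc _ ≤ |∑ i ∈ range (a + 1), ee σ q (c + i)| + |∑ i ∈ range a, ee σ q (d + i)| := abs_sub _ _
      _ ≤ 2 ^ q * (√ZZ * √((a + 1 : ℕ) : ℝ)) + 2 ^ q * (√ZZ * √(a : ℝ)) := by
        gcongr
        · exact (abs_sum_le_sum_abs _ _).trans h1
        · exact (abs_sum_le_sum_abs _ _).trans h2
      _ ≤ 2 ^ q * (√ZZ * (√2 * √((a : ℝ) + 1 / 2))) + 2 ^ q * (√ZZ * (√2 * √((a : ℝ) + 1 / 2))) := by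
        gcongr
      _ = _ := by ring
  rcases int_cases n with ⟨a, rfl⟩ | ⟨a, rfl⟩
  · rw [RR_pos]
    have := aux M 0 a
    rw [XX_nat, abs_of_pos (show (0 : ℝ) < (a : ℝ) + 1 / 2 by positivity)]
    exact this
  · rw [RR_neg]
    have := aux (-((a : ℤ) + 1)) ((M : ℤ) - a) a
    rw [XX_neg, abs_neg, XX_nat, abs_of_pos (show (0 : ℝ) < (a : ℝ) + 1 / 2 by positivity)]
    exact this

lemma pow_X_bound (p : ℕ) (hp : 2 ≤ p) (n : ℤ) :
    (|XX n|⁻¹) ^ p * √|XX n| ≤ 2 ^ p * (1 / |XX n| ^ (3 / 2 : ℝ)) := by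
  have h1 := XX_pos n
  have h2 := XX_inv n
  have h3 : (|XX n|⁻¹) ^ 2 * √|XX n| = 1 / |XX n| ^ (3 / 2 : ℝ) := by
    rw [Real.sqrt_eq_rpow, one_div (|XX n| ^ (3 / 2 : ℝ)), ← Real.rpow_neg h1.le, inv_pow, ← Real.rpow_natCast,
      ← Real.rpow_neg h1.le, ← Real.rpow_add h1]
    norm_num
  obtain ⟨p, rfl⟩ : ∃ p', p = p' + 2 := ⟨p - 2, by omega⟩
  rw [← h3, pow_add, mul_assoc]
  gcongr
  calc (|XX n|⁻¹) ^ p ≤ 2 ^ p := by gcongr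
    _ ≤ 2 ^ (p + 2) := pow_le_pow_right₀ (by norm_num) (by omega)

noncomputable def FF (σ1 σ2 : ℝ) (p q M : ℕ) (n : ℤ) : ℝ := σ1 ^ n / XX n ^ p * RR σ2 q M n

lemma FF_bound {σ1 σ2 : ℝ} (h1 : σ1 = 1 ∨ σ1 = -1) (h2 : σ2 = 1 ∨ σ2 = -1) (p q : ℕ) (hp : 2 ≤ p)
    (hq : 1 ≤ q) (M : ℕ) (n : ℤ) : |FF σ1 σ2 p q M n| ≤
      (2 * 2 ^ q * √ZZ * √2 * 2 ^ p) * (1 / |XX n| ^ (3 / 2 : ℝ)) := by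
  unfold FF
  rw [abs_mul, abs_div, sgn_abs h1, abs_pow, one_div, ← inv_pow]
  have h := XX_pos n
  calc _ ≤ (|XX n|⁻¹) ^ p * (2 * 2 ^ q * √ZZ * √2 * √|XX n|) := by
        gcongr
        exact RR_bound h2 q hq M n
    _ = (2 * 2 ^ q * √ZZ * √2) * ((|XX n|⁻¹) ^ p * √|XX n|) := by ring
    _ ≤ (2 * 2 ^ q * √ZZ * √2) * (2 ^ p * (1 / |XX n| ^ (3 / 2 : ℝ))) := by
        exact mul_le_mul_of_nonneg_left (pow_X_bound p hp n) (by positivity)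
    _ = _ := by ring

lemma bound_summ (K : ℝ) : Summable (fun n : ℤ => K * (1 / |XX n| ^ (3 / 2 : ℝ))) :=
  (summ_X (by norm_num)).mul_left K

lemma FF_tsum {σ1 σ2 : ℝ} (h1 : σ1 = 1 ∨ σ1 = -1) (h2 : σ2 = 1 ∨ σ2 = -1) (p q : ℕ) (hp : 2 ≤ p)
    (M : ℕ) : ∑' n, FF σ1 σ2 p q M n = CC (σ1 * σ2) p q 0 +
      ∑ m ∈ range M, σ2 ^ (m + 1) * CC (σ1 * σ2) p q ((m + 1 : ℕ) : ℤ) -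
      (∑ m ∈ range M, σ2 ^ m / ((m : ℝ) + 1 / 2) ^ q) * CC σ1 p 0 0 := by
  have h12 : σ1 * σ2 = 1 ∨ σ1 * σ2 = -1 := by
    rcases h1 with rfl | rfl <;> rcases h2 with rfl | rfl <;> simp
  have e : ∀ n, FF σ1 σ2 p q M n = ∑ m ∈ range (M + 1), σ2 ^ m * cterm (σ1 * σ2) p q m n -
      (∑ m ∈ range M, σ2 ^ m / ((m : ℝ) + 1 / 2) ^ q) * cterm σ1 p 0 0 n := by
    intro n
    unfold FF RR
    rw [mul_sub, mul_sum]
    congr 1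
    · refine sum_congr rfl fun m _ => ?_
      unfold ee cterm
      rw [zpow_add₀ (sgn_ne h2), mul_zpow, zpow_natCast]
      field_simp
    · unfold ee cterm
      simp only [XX_nat, zpow_natCast]
      simp
      ring
  rw [tsum_congr e, Summable.tsum_sub, Summable.tsum_finsetSum, tsum_mul_left]
  · rw [sum_range_succ']
    simp only [tsum_mul_left]
    unfold CC
    simp
    ring
  · intro m _
    exact (cterm_summ h12 p q (by omega) m).mul_left _
  · exact summable_sum fun m _ => (cterm_summ h12 p q (by omega) m).mul_left _
  · exact (cterm_summ h1 p 0 (by omega) 0).mul_left _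

noncomputable def Rlim (σ : ℝ) (q : ℕ) (n : ℤ) : ℝ :=
  if 0 ≤ n then -∑ i ∈ range n.toNat, ee σ q (0 + i) else ∑ i ∈ range (-n).toNat, ee σ q (n + i)

lemma Rlim_pos (σ : ℝ) (q a : ℕ) : Rlim σ q a = -∑ i ∈ range a, ee σ q (0 + i) := by
  simp [Rlim]

lemma Rlim_neg (σ : ℝ) (q a : ℕ) : Rlim σ q (-((a : ℤ) + 1)) =
    ∑ i ∈ range (a + 1), ee σ q (-((a : ℤ) + 1) + i) := by
  unfold Rlim
  rw [if_neg (by omega), neg_neg]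
  congr 1

lemma ee_tend {σ : ℝ} (h : σ = 1 ∨ σ = -1) (q : ℕ) (hq : 1 ≤ q) (c : ℤ) :
    Tendsto (fun M : ℕ => ee σ q (M + c)) atTop (𝓝 0) := by
  rw [tendsto_zero_iff_abs_tendsto_zero]
  have h0 := ((half_tend ((c : ℝ) + 1 / 2)).abs).const_mul (2 ^ q)
  rw [abs_zero, mul_zero] at h0
  refine squeeze_zero (fun M => abs_nonneg _) (fun M => ?_) h0
  refine (ee_abs h q hq _).trans (le_of_eq ?_)
  unfold XX
  push_cast
  rw [abs_div, abs_one, one_div |_|, add_assoc]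

lemma RR_tend {σ : ℝ} (h : σ = 1 ∨ σ = -1) (q : ℕ) (hq : 1 ≤ q) (n : ℤ) :
    Tendsto (fun M : ℕ => RR σ q M n) atTop (𝓝 (Rlim σ q n)) := by
  rcases int_cases n with ⟨a, rfl⟩ | ⟨a, rfl⟩
  · simp only [RR_pos, Rlim_pos]
    have h1 : Tendsto (fun M : ℕ => ∑ i ∈ range (a + 1), ee σ q (M + i)) atTop
        (𝓝 (∑ i ∈ range (a + 1), (0 : ℝ))) := tendsto_finsetSum _ fun i _ => ee_tend h q hq i
    have := h1.sub_const (∑ i ∈ range a, ee σ q (0 + i))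
    simpa using this
  · simp only [RR_neg, Rlim_neg]
    have h1 : Tendsto (fun M : ℕ => ∑ i ∈ range a, ee σ q ((M : ℤ) - a + i)) atTop
        (𝓝 (∑ i ∈ range a, (0 : ℝ))) := tendsto_finsetSum _ fun i _ => by
      have := ee_tend h q hq (-a + i)
      refine this.congr fun M => ?_
      congr 1
      ring
    have := h1.const_sub (∑ i ∈ range (a + 1), ee σ q (-((a : ℤ) + 1) + i))
    simpa using this

noncomputable def tt (σ1 σ2 : ℝ) (p q a : ℕ) : ℝ :=
  σ1 ^ a / ((a : ℝ) + 1 / 2) ^ p * ∑ b ∈ range a, σ2 ^ b / ((b : ℝ) + 1 / 2) ^ q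

lemma G_pos (σ1 σ2 : ℝ) (p q a : ℕ) :
    σ1 ^ (a : ℤ) / XX a ^ p * Rlim σ2 q a = -tt σ1 σ2 p q a := by
  rw [Rlim_pos]
  unfold tt ee
  simp [XX_nat]

lemma G_neg {σ1 σ2 : ℝ} (h1 : σ1 = 1 ∨ σ1 = -1) (h2 : σ2 = 1 ∨ σ2 = -1) (p q a : ℕ)
    (hpar : (-1 : ℝ) ^ (p + q) = -(σ1 * σ2)) :
    σ1 ^ (-((a : ℤ) + 1)) / XX (-((a : ℤ) + 1)) ^ p * Rlim σ2 q (-((a : ℤ) + 1)) =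
      -(tt σ1 σ2 p q a + (σ1 * σ2) ^ a / ((a : ℝ) + 1 / 2) ^ (p + q)) := by
  have e1 : ∀ (τ : ℝ) (hτ : τ = 1 ∨ τ = -1) (r b : ℕ), τ ^ (-((b : ℤ) + 1)) / XX (-((b : ℤ) + 1)) ^ r =
      (τ * (-1) ^ r) * (τ ^ b / ((b : ℝ) + 1 / 2) ^ r) := by
    intro τ hτ r b
    rw [sgn_neg hτ, zpow_add₀ (sgn_ne hτ), zpow_natCast, zpow_one, XX_neg, XX_nat, neg_pow]
    have h1 : (-1 : ℝ) ^ r * (-1) ^ r = 1 := by rw [← mul_pow]; simp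
    have h2 : (-1 : ℝ) ^ r ≠ 0 := by simp
    field_simp
    rw [pow_two, h1, mul_one]
  have e2 : Rlim σ2 q (-((a : ℤ) + 1)) = (σ2 * (-1) ^ q) *
      (∑ b ∈ range a, σ2 ^ b / ((b : ℝ) + 1 / 2) ^ q + σ2 ^ a / ((a : ℝ) + 1 / 2) ^ q) := by
    rw [Rlim_neg, ← sum_range_reflect, ← sum_range_succ (fun b : ℕ => σ2 ^ b / ((b : ℝ) + 1 / 2) ^ q), mul_sum]
    refine sum_congr rfl fun b hb => ?_
    rw [mem_range] at hb
    rw [← e1 σ2 h2 q b]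
    unfold ee
    have : -((a : ℤ) + 1) + ((a + 1 - 1 - b : ℕ) : ℤ) = -((b : ℤ) + 1) := by omega
    rw [this]
  rw [e2, e1 σ1 h1]
  unfold tt
  have e3 : σ1 * (-1) ^ p * (σ2 * (-1) ^ q) = -1 := by
    rw [show σ1 * (-1) ^ p * (σ2 * (-1) ^ q) = σ1 * σ2 * (-1) ^ (p + q) by rw [pow_add]; ring, hpar]
    have a1 := sgn_sq h1
    have a2 := sgn_sq h2
    linear_combination (-σ2 * σ2) * a1 - a2
  rw [pow_add, mul_pow]
  have e4 : ∀ A B S : ℝ, (σ1 * (-1) ^ p * A) * (σ2 * (-1) ^ q * (S + B)) = -(A * S + A * B) := by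
    intro A B S
    linear_combination (A * (S + B)) * e3
  rw [e4]
  congr 2
  field_simp

lemma main_tt {σ1 σ2 : ℝ} (h1 : σ1 = 1 ∨ σ1 = -1) (h2 : σ2 = 1 ∨ σ2 = -1) (p q : ℕ) (hp : 2 ≤ p)
    (hq : 1 ≤ q) (hpar : (-1 : ℝ) ^ (p + q) = -(σ1 * σ2)) : ∑' a, tt σ1 σ2 p q a ∈ AA := by
  have h12 : σ1 * σ2 = 1 ∨ σ1 * σ2 = -1 := by
    rcases h1 with rfl | rfl <;> rcases h2 with rfl | rfl <;> simp
  obtain ⟨l, hl, ht⟩ := rhs_tend h1 h2 p q hp hq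
  obtain ⟨w, hw, hs⟩ := lsum _ h12 (p + q) (by omega)
  set G : ℤ → ℝ := fun n => σ1 ^ n / XX n ^ p * Rlim σ2 q n with hG
  have hpt : ∀ n, Tendsto (fun M => FF σ1 σ2 p q M n) atTop (𝓝 (G n)) := fun n =>
    (RR_tend h2 q hq n).const_mul _
  have hb := bound_summ (2 * 2 ^ q * √ZZ * √2 * 2 ^ p)
  have hlim := tendsto_tsum_of_dominated_convergence hb hpt
    (Eventually.of_forall fun M n => FF_bound h1 h2 p q hp hq M n)
  simp only [FF_tsum h1 h2 p q hp] at hlim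
  have hGl : ∑' n, G n = l := tendsto_nhds_unique hlim ht
  have hGs : Summable G := Summable.of_norm_bounded hb fun n =>
    le_of_tendsto (hpt n).abs (Eventually.of_forall fun M => FF_bound h1 h2 p q hp hq M n)
  have hinj : Function.Injective (fun n : ℕ => -((n : ℤ) + 1)) := fun a b h => by
    have : -((a : ℤ) + 1) = -((b : ℤ) + 1) := h
    omega
  have s1 := hGs.comp_injective (i := fun n : ℕ => (n : ℤ)) Nat.cast_injective
  have s2 := hGs.comp_injective hinj
  have e : ∑' n, G n = _ := tsum_of_nat_of_neg_add_one s1 s2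
  have hts : Summable (tt σ1 σ2 p q) := by
    refine s1.neg.congr fun a => ?_
    have := G_pos σ1 σ2 p q a
    simp only [Function.comp, hG, this, neg_neg]
  have e1 : ∑' a : ℕ, G a = -∑' a, tt σ1 σ2 p q a := by
    rw [← tsum_neg]
    exact tsum_congr fun a => G_pos σ1 σ2 p q a
  have e2 : ∑' a : ℕ, G (-((a : ℤ) + 1)) = -(∑' a, tt σ1 σ2 p q a + w) := by
    rw [← hs.tsum_eq, ← Summable.tsum_add hts hs.summable, ← tsum_neg]
    exact tsum_congr fun a => G_neg h1 h2 p q a hpar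
  rw [hGl, e1, e2] at e
  have : ∑' a, tt σ1 σ2 p q a = ((-1 / 2 : ℚ) : ℝ) * (l + w) := by
    push_cast
    linarith
  rw [this]
  exact AA_ratmul _ (AA.add_mem hl hw)

noncomputable def idx : (Σ a : ℕ, Fin a) ≃ {p : ℕ × ℕ // 0 < p.2 ∧ p.2 < p.1} where
  toFun s := ⟨(s.1 + 1, s.2.1 + 1), by have := s.2.2; simp⟩
  invFun x := ⟨x.1.1 - 1, ⟨x.1.2 - 1, by have := x.2; omega⟩⟩
  left_inv s := by
    rcases s with ⟨a, b, hb⟩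
    simp
  right_inv x := by
    rcases x with ⟨⟨a, b⟩, h1, h2⟩
    simp only at h1 h2
    ext <;> simp <;> omega

lemma dtt_eq {σ1 σ2 : ℝ} (h1 : σ1 = 1 ∨ σ1 = -1) (h2 : σ2 = 1 ∨ σ2 = -1) (p q : ℕ) (hp : 2 ≤ p)
    (hq : 1 ≤ q) : dtt p q σ1 σ2 = σ1 * σ2 * ∑' a, tt σ1 σ2 p q a := by
  unfold dtt
  rw [← idx.tsum_eq]
  have e : ∀ s : (Σ a : ℕ, Fin a), σ1 ^ (idx s).1.1 * σ2 ^ (idx s).1.2 /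
      ((((idx s).1.1 : ℝ) - 1 / 2) ^ p * (((idx s).1.2 : ℝ) - 1 / 2) ^ q) =
      σ1 * σ2 * (σ1 ^ s.1 / ((s.1 : ℝ) + 1 / 2) ^ p * (σ2 ^ s.2.1 / ((s.2.1 : ℝ) + 1 / 2) ^ q)) := by
    intro s
    simp only [idx, Equiv.coe_fn_mk]
    push_cast
    rw [show (s.1 : ℝ) + 1 - 1 / 2 = s.1 + 1 / 2 by ring, show (s.2.1 : ℝ) + 1 - 1 / 2 = s.2.1 + 1 / 2 by ring]
    field_simp
    ring
  rw [tsum_congr e, tsum_mul_left, Summable.tsum_sigma]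
  · congr 1
    refine tsum_congr fun a => ?_
    rw [tsum_fintype]
    unfold tt
    rw [mul_sum, Fin.sum_univ_eq_sum_range (fun b : ℕ => σ1 ^ a / ((a : ℝ) + 1 / 2) ^ p *
      (σ2 ^ b / ((b : ℝ) + 1 / 2) ^ q)) a]
  · rw [← summable_abs_iff, summable_sigma_of_nonneg (fun s => abs_nonneg _)]
    refine ⟨fun a => Summable.of_finite, ?_⟩
    have hb : Summable (fun a : ℕ => (2 ^ q * √ZZ * 2 ^ p) * (1 / |XX (a : ℤ)| ^ (3 / 2 : ℝ))) :=
      (bound_summ (2 ^ q * √ZZ * 2 ^ p)).comp_injective (i := fun n : ℕ => (n : ℤ)) Nat.cast_injective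
    refine Summable.of_nonneg_of_le (fun a => tsum_nonneg fun b => abs_nonneg _) (fun a => ?_) hb
    rw [tsum_fintype]
    rw [Fin.sum_univ_eq_sum_range (fun b : ℕ => |σ1 ^ a / ((a : ℝ) + 1 / 2) ^ p *
      (σ2 ^ b / ((b : ℝ) + 1 / 2) ^ q)|) a]
    have h3 := window_ee h2 q hq 0 a
    have h4 : √(a : ℝ) ≤ √|XX (a : ℤ)| := by
      apply Real.sqrt_le_sqrt
      rw [XX_nat, abs_of_pos (by positivity)]
      linarith
    have h5 := pow_X_bound p hp a
    have h6 := XX_pos a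
    have h7 : |σ1 ^ a / ((a : ℝ) + 1 / 2) ^ p| = (|XX (a : ℤ)|⁻¹) ^ p := by
      have := sgn_abs h1 a
      rw [zpow_natCast] at this
      rw [abs_div, this, XX_nat, abs_pow, one_div, inv_pow]
    calc _ = |σ1 ^ a / ((a : ℝ) + 1 / 2) ^ p| * ∑ i ∈ range a, |ee σ2 q (0 + i)| := by
          rw [mul_sum]
          refine sum_congr rfl fun b _ => ?_
          rw [abs_mul]
          simp [ee, XX_nat]
      _ ≤ (|XX (a : ℤ)|⁻¹) ^ p * (2 ^ q * (√ZZ * √|XX (a : ℤ)|)) := by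
          rw [h7]
          gcongr
          refine h3.trans ?_
          gcongr
      _ = (2 ^ q * √ZZ) * ((|XX (a : ℤ)|⁻¹) ^ p * √|XX (a : ℤ)|) := by ring
      _ ≤ (2 ^ q * √ZZ) * (2 ^ p * (1 / |XX (a : ℤ)| ^ (3 / 2 : ℝ))) :=
          mul_le_mul_of_nonneg_left h5 (by positivity)
      _ = _ := by ring

lemma dtt_one {σ1 σ2 : ℝ} (h1 : σ1 = 1 ∨ σ1 = -1) (h2 : σ2 = 1 ∨ σ2 = -1) (q : ℕ) :
    dtt 1 q σ1 σ2 = 0 := by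
  unfold dtt
  refine tsum_eq_zero_of_not_summable fun hs => ?_
  let i : ℕ → {p : ℕ × ℕ // 0 < p.2 ∧ p.2 < p.1} := fun n => ⟨(n + 2, 1), by simp⟩
  have hi : Function.Injective i := fun a b h => by
    have := congrArg (fun x => x.1.1) h
    simpa [i] using this
  have h3 := ((hs.comp_injective hi).abs).mul_left |(1 / 2 : ℝ) ^ q|
  have h4 : Summable (fun n : ℕ => 1 / ((n : ℝ) + 3 / 2)) := by
    refine h3.congr fun n => ?_
    simp only [Function.comp, i]
    have e1 := sgn_abs h1 (n + 2 : ℕ)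
    have e2 := sgn_abs h2 (1 : ℕ)
    rw [zpow_natCast] at e1 e2
    rw [abs_div, abs_mul, e1, e2, abs_mul, pow_one]
    push_cast
    rw [show (n : ℝ) + 2 - 1 / 2 = n + 3 / 2 by ring, abs_of_pos (show (0 : ℝ) < n + 3 / 2 by positivity),
      show (1 : ℝ) - 1 / 2 = 1 / 2 by ring]
    have : |(1 / 2 : ℝ) ^ q| ≠ 0 := by simp
    field_simp
  have h5 : Summable (fun n : ℕ => 1 / ((n + 2 : ℕ) : ℝ)) := by
    refine Summable.of_nonneg_of_le (fun n => by positivity) (fun n => ?_) h4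
    push_cast
    gcongr
    norm_num
  exact Real.not_summable_one_div_natCast ((summable_nat_add_iff 2).1 h5)

theorem stmt6 (p q : ℕ) (hp : 1 ≤ p) (hq : 1 ≤ q) (σ1 σ2 : ℝ)
    (h1 : σ1 = 1 ∨ σ1 = -1) (h2 : σ2 = 1 ∨ σ2 = -1)
    (hne : ¬(p = 1 ∧ σ1 = 1))
    (hpar : (-1 : ℝ) ^ (p + q) = -(σ1 * σ2)) :
    dtt p q σ1 σ2 ∈ Algebra.adjoin ℚ
      ({Real.pi, Real.log 2, betaVal 2}
        ∪ {x : ℝ | ∃ k : ℕ, 1 ≤ k ∧ x = zetaVal (2 * k + 1)}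
        ∪ {x : ℝ | ∃ k : ℕ, 2 ≤ k ∧ x = betaVal (2 * k)}) := by
  change dtt p q σ1 σ2 ∈ AA
  by_cases h : p = 1
  · subst h
    rw [dtt_one h1 h2]
    exact AA.zero_mem
  · rw [dtt_eq h1 h2 p q (by omega) hq]
    have hm := main_tt h1 h2 p q (by omega) hq hpar
    refine AA.mul_mem ?_ hm
    rcases h1 with rfl | rfl <;> rcases h2 with rfl | rfl <;> simp
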